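/- arXiv:2603.27045 — 2 statements merged into one kernel-verified Lean document; each statement's English description precedes it below -/
import Mathlib

section
/- Let G be a finite abelian group, let p ≥ 1 be an integer, let C₁, C₂ ⊆ G be nonempty with densities γ₁ and γ₂ respectively, let μ = μ_{C₁}∘μ_{C₂}, let A ⊆ G be nonempty with density α, and let f : G → ℝ. For s = (s₁, …, s_p) ∈ G^p, set A₁(s) = C₁ ∩ (A+s₁) ∩ ⋯ ∩ (A+s_p) and A₂(s) = C₂ ∩ (A+s₁) ∩ ⋯ ∩ (A+s_p), with densities α₁(s), α₂(s) (with the convention that a term is 0 whenever A₁(s) or A₂(s) is empty). Then ⟨(μ_A∘μ_A)^p, f⟩_μ = |G|^{−p}·α^{−2p}·γ₁^{−1}·γ₂^{−1}·Σ_{s∈G^p} α₁(s)·α₂(s)·⟨μ_{A₁(s)}∘μ_{A₂(s)}, f⟩. In particular (taking f = 1), if ‖μ_A∘μ_A‖_{p(μ)} > 0 then ℙ(s) = α₁(s)·α₂(s) / (|G|^p·α^{2p}·γ₁·γ₂·‖μ_A∘μ_A‖_{p(μ)}^p) satisfies Σ_{s∈G^p} ℙ(s) = 1. -/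
open Finset BigOperators Pointwise
open scoped Classical

namespace Formal

variable {G : Type*} [AddCommGroup G] [Fintype G]

/-- `ex f = 𝔼_{x ∈ G} f x`. -/
noncomputable def ex (f : G → ℝ) : ℝ := (∑ x, f x) / (Fintype.card G : ℝ)

/-- `ip f g = ⟨f, g⟩ = 𝔼_x f x * g x`. -/
noncomputable def ip (f g : G → ℝ) : ℝ := ex (fun x => f x * g x)

/-- `ipWt ν f g = ⟨f, g⟩_ν = 𝔼_x f x * g x * ν x`. -/
noncomputable def ipWt (ν f g : G → ℝ) : ℝ := ex (fun x => f x * g x * ν x)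

/-- Convolution `f ∗ g (x) = 𝔼_y f y * g (x - y)`. -/
noncomputable def cv (f g : G → ℝ) : G → ℝ := fun x => ex (fun y => f y * g (x - y))

/-- Difference convolution `f ∘ g (x) = 𝔼_y f y * g (x + y)`. -/
noncomputable def dcv (f g : G → ℝ) : G → ℝ := fun x => ex (fun y => f y * g (x + y))

/-- Normalized indicator measure `μ_A = (|G|/|A|) · 1_A`. -/
noncomputable def mu (A : Set G) : G → ℝ :=
  fun x => if x ∈ A then (Fintype.card G : ℝ) / (Nat.card A : ℝ) else 0

/-- Density `|A|/|G|`. -/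
noncomputable def density (A : Set G) : ℝ := (Nat.card A : ℝ) / (Fintype.card G : ℝ)

/-- Relative density `|A|/|B|`. -/
noncomputable def relDensity (A B : Set G) : ℝ := (Nat.card A : ℝ) / (Nat.card B : ℝ)

/-- `‖f‖_p = (𝔼_x |f x|^p)^{1/p}`. -/
noncomputable def lpNorm (p : ℝ) (f : G → ℝ) : ℝ := (ex (fun x => |f x| ^ p)) ^ (1 / p)

/-- `‖f‖_{p(ν)} = (𝔼_x |f x|^p ν x)^{1/p}`. -/
noncomputable def lpNormWt (p : ℝ) (ν f : G → ℝ) : ℝ := (ex (fun x => |f x| ^ p * ν x)) ^ (1 / p)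

/-- `‖f‖_∞ = max_x |f x|`. -/
noncomputable def linftyNorm (f : G → ℝ) : ℝ := ⨆ x, |f x|

/-- `‖f‖_1 = 𝔼_x |f x|`. -/
noncomputable def l1Norm (f : G → ℝ) : ℝ := ex (fun x => |f x|)

/-- Indicator function of a set. -/
noncomputable def indic (S : Set G) : G → ℝ := fun x => if x ∈ S then 1 else 0

/-- `Lq α = log (2/α)`. -/
noncomputable def Lq (α : ℝ) : ℝ := Real.log (2 / α)

/-- `iterConv f k` is the `k`-fold convolution `f ∗ ⋯ ∗ f` (for `k ≥ 1`);
`iterConv f 0` is the convolution identity. -/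
noncomputable def iterConv (f : G → ℝ) : ℕ → G → ℝ
  | 0 => fun x => if x = 0 then (Fintype.card G : ℝ) else 0
  | n + 1 => cv (iterConv f n) f

/-- Fourier transform `f̂ γ = 𝔼_x f x * conj (γ x)`. -/
noncomputable def ft (f : G → ℝ) (γ : AddChar G ℂ) : ℂ :=
  (∑ x, (f x : ℂ) * (starRingEnd ℂ) (γ x)) / (Fintype.card G : ℝ)

/-- The large spectrum `Δ_{1/2}(X)` of the measure `μ_X`. -/
noncomputable def Delta (X : Set G) : Set (AddChar G ℂ) :=
  {γ | 1 / 2 ≤ ‖ft (mu X) γ‖}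

/-- A Bohr set: a finite set of characters together with a radius. -/
structure Bohr (G : Type*) [AddCommGroup G] where
  freq : Finset (AddChar G ℂ)
  radius : ℝ

namespace Bohr

variable {G : Type*} [AddCommGroup G]

/-- The underlying set `{x : |1 - γ x| ≤ ρ for all γ ∈ Λ}` of a Bohr set. -/
def carrier (B : Bohr G) : Set G := {x | ∀ γ ∈ B.freq, ‖(1 : ℂ) - γ x‖ ≤ B.radius}

/-- The rank `|Λ|` of a Bohr set. -/
def rank (B : Bohr G) : ℕ := B.freq.card

/-- The dilate `B_δ` of a Bohr set. -/
def dilate (B : Bohr G) (δ : ℝ) : Bohr G := ⟨B.freq, δ * B.radius⟩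

/-- A Bohr set of rank `d` is regular if for all `|κ| ≤ 1/(100d)`,
`(1 - 100d|κ|)|B| ≤ |B_{1+κ}| ≤ (1 + 100d|κ|)|B|`. -/
def Regular (B : Bohr G) : Prop :=
  ∀ κ : ℝ, |κ| ≤ 1 / (100 * B.rank) →
    (1 - 100 * B.rank * |κ|) * (Nat.card B.carrier : ℝ) ≤
        (Nat.card ((B.dilate (1 + κ)).carrier) : ℝ) ∧
    (Nat.card ((B.dilate (1 + κ)).carrier) : ℝ) ≤
        (1 + 100 * B.rank * |κ|) * (Nat.card B.carrier : ℝ)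

/-- `B' ⊂_r B` : `B'` is a regular dilate `B_δ` of `B` with `δ ∈ [r/2, r]`. -/
def subR (r : ℝ) (B' B : Bohr G) : Prop :=
  ∃ δ : ℝ, r / 2 ≤ δ ∧ δ ≤ r ∧ B' = B.dilate δ ∧ B'.Regular

/-- The density `μ(B) = |B|/|G|` of a Bohr set. -/
noncomputable def dens (B : Bohr G) : ℝ := (Nat.card B.carrier : ℝ) / (Nat.card G : ℝ)

end Bohr


theorem mu_eq_inv_density_mul_indic {G : Type*} [Fintype G] (A : Set G) (x : G) :
    mu A x = (density A)⁻¹ * indic A x := by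
  simp [mu, density, indic]

theorem indic_eq_zero_of_density_eq_zero {A : Set G} (hA : density A = 0) (x : G) :
    indic A x = 0 := by
  have hG : (Fintype.card G : ℝ) ≠ 0 := by simp
  have hcard : Nat.card A = 0 := by
    simpa only [density, div_eq_zero_iff, hG, or_false, Nat.cast_eq_zero] using hA
  have hempty : A = ∅ := by
    rcases Set.eq_empty_or_nonempty A with h | h
    · exact h
    · have := h.to_subtype
      exact absurd hcard Nat.card_pos.ne'
  simp [indic, hempty]

theorem density_ne_zero {A : Set G} (hA : A.Nonempty) : density A ≠ 0 := by
  obtain ⟨x, hx⟩ := hA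
  intro h
  simpa [indic, hx] using indic_eq_zero_of_density_eq_zero h x

theorem density_mul_mu (A : Set G) (x : G) : density A * mu A x = indic A x := by
  rw [mu_eq_inv_density_mul_indic]
  by_cases h : density A = 0
  · simp [indic_eq_zero_of_density_eq_zero h]
  · rw [mul_inv_cancel_left₀ h]

theorem ex_const_mul {G : Type*} [Fintype G] (c : ℝ) (f : G → ℝ) : ex (fun x => c * f x) = c * ex f := by
  simp only [ex, ← Finset.mul_sum, mul_div_assoc]

theorem ex_sum {G ι : Type*} [Fintype G] (t : Finset ι) (F : ι → G → ℝ) :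
    ex (fun x => ∑ i ∈ t, F i x) = ∑ i ∈ t, ex (F i) := by
  simp only [ex]
  rw [Finset.sum_comm, Finset.sum_div]

theorem ex_indic {G : Type*} [Fintype G] (A : Set G) : ex (indic A) = density A := by
  simp only [ex, indic, density]
  congr 1
  rw [Finset.sum_boole, Nat.card_eq_fintype_card, Fintype.card_subtype]

theorem dcv_mu (A B : Set G) (x : G) :
    dcv (mu A) (mu B) x = (density A)⁻¹ * (density B)⁻¹ * dcv (indic A) (indic B) x := by
  simp only [dcv, ← ex_const_mul, mu_eq_inv_density_mul_indic]
  congr 1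
  ext y
  ring

theorem density_mul_density_mul_ip (A B : Set G) (f : G → ℝ) :
    density A * density B * ip (dcv (mu A) (mu B)) f = ip (dcv (indic A) (indic B)) f := by
  simp only [ip, dcv, ← ex_const_mul]
  congr 1
  ext x
  rw [← mul_assoc, ← ex_const_mul]
  congr 2
  ext y
  rw [← density_mul_mu A, ← density_mul_mu B]
  ring

theorem ip_dcv_indic_one (A B : Set G) :
    ip (dcv (indic A) (indic B)) (fun _ => 1) = density A * density B := by
  have hshift (y : G) : ∑ x, indic B (x + y) = ∑ x, indic B x :=
    Equiv.sum_comp (Equiv.addRight y) (indic B)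
  rw [← ex_indic A, ← ex_indic B]
  simp only [ip, dcv, ex, mul_one]
  rw [← Finset.sum_div, Finset.sum_comm]
  simp only [← Finset.mul_sum, hshift, ← Finset.sum_mul]
  ring

theorem indic_inter_iInter_translates {G : Type*} [AddCommGroup G] {p : ℕ} (C A : Set G)
    (s : Fin p → G) (y : G) :
    indic (C ∩ ⋂ i, (fun a => a + s i) '' A) y = indic C y * ∏ i, indic A (y - s i) := by
  have hmem (i : Fin p) : y ∈ (fun a => a + s i) '' A ↔ y - s i ∈ A := by
    simp [sub_eq_add_neg]
  simp only [indic, Set.mem_inter_iff, Set.mem_iInter, hmem, Finset.prod_boole,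
    Finset.mem_univ, forall_true_left, ite_and, ite_mul, one_mul, zero_mul]

theorem sum_indic_sub_mul_indic_sub (A : Set G) (x y : G) :
    ∑ s, indic A (y - s) * indic A (x + y - s) =
      Fintype.card G * dcv (indic A) (indic A) x := by
  have hG : (Fintype.card G : ℝ) ≠ 0 := by simp
  rw [dcv, ex, mul_div_cancel₀ _ hG,
    ← Equiv.sum_comp (Equiv.subLeft y) (fun t => indic A t * indic A (x + t))]
  simp [add_sub_assoc]

theorem sum_dcv_indic_inter_translates {p : ℕ} (C₁ C₂ A : Set G) (x : G) :
    ∑ s : Fin p → G, dcv (indic (C₁ ∩ ⋂ i, (fun a => a + s i) '' A))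
        (indic (C₂ ∩ ⋂ i, (fun a => a + s i) '' A)) x =
      (Fintype.card G : ℝ) ^ p * dcv (indic A) (indic A) x ^ p *
        dcv (indic C₁) (indic C₂) x := by
  rw [← mul_pow]
  simp only [dcv, ← ex_sum, indic_inter_iInter_translates, ← ex_const_mul]
  congr 1
  ext y
  have h := sum_indic_sub_mul_indic_sub A x y
  simp only [dcv, ← ex_const_mul] at h
  rw [← h, Fintype.sum_pow, Finset.sum_mul]
  refine Finset.sum_congr rfl fun s _ => ?_
  rw [Finset.prod_mul_distrib]
  ring

theorem ipWt_dcv_mu_pow (p : ℕ) (C₁ C₂ A : Set G) (f : G → ℝ) :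
    ipWt (dcv (mu C₁) (mu C₂)) (fun x => dcv (mu A) (mu A) x ^ p) f =
      (Fintype.card G : ℝ) ^ (-(p : ℤ)) * density A ^ (-(2 * (p : ℤ))) *
        (density C₁)⁻¹ * (density C₂)⁻¹ *
        ∑ s : Fin p → G, ip (dcv (indic (C₁ ∩ ⋂ i, (fun a => a + s i) '' A))
          (indic (C₂ ∩ ⋂ i, (fun a => a + s i) '' A))) f := by
  have hG : (Fintype.card G : ℝ) ≠ 0 := by simp
  have hpow : density A ^ (-(2 * (p : ℤ))) = ((density A)⁻¹ * (density A)⁻¹) ^ p := by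
    rw [zpow_neg, zpow_mul, zpow_natCast, ← mul_inv, inv_pow]
    norm_cast
    rw [sq]
  simp only [ipWt, ip, ← ex_sum, ← Finset.sum_mul, sum_dcv_indic_inter_translates,
    ← ex_const_mul]
  congr 1
  ext x
  rw [dcv_mu, dcv_mu, hpow, zpow_neg, zpow_natCast, mul_pow]
  field_simp

theorem lpNormWt_pow {p : ℕ} (hp : p ≠ 0) {ν f : G → ℝ} (hν : 0 ≤ ν) (hf : 0 ≤ f) :
    lpNormWt p ν f ^ p = ipWt ν (fun x => f x ^ p) (fun _ => 1) := by
  have hnonneg : 0 ≤ ex (fun x => |f x| ^ (p : ℝ) * ν x) :=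
    div_nonneg (Finset.sum_nonneg fun x _ => mul_nonneg (by positivity) (hν x)) (by positivity)
  rw [lpNormWt, one_div, Real.rpow_inv_natCast_pow hnonneg hp, ipWt]
  congr 1
  ext x
  rw [abs_of_nonneg (hf x), Real.rpow_natCast, mul_one]

theorem dcv_mu_nonneg (A B : Set G) : 0 ≤ dcv (mu A) (mu B) := by
  have hmu (C : Set G) (x : G) : 0 ≤ mu C x := by
    unfold mu
    split_ifs <;> positivity
  exact fun x => div_nonneg
    (Finset.sum_nonneg fun y _ => mul_nonneg (hmu A y) (hmu B (x + y))) (by positivity)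

/-- The weighted sifting identity: with `μ = μ_{C₁}∘μ_{C₂}`,
`⟨(μ_A∘μ_A)^p, f⟩_μ = |G|^{−p} α^{−2p} γ₁⁻¹ γ₂⁻¹ Σ_s α₁(s) α₂(s) ⟨μ_{A₁(s)}∘μ_{A₂(s)}, f⟩`,
and in particular the corresponding `ℙ(s)` is a probability measure on `G^p`. -/
theorem statement9 {G : Type*} [AddCommGroup G] [Fintype G]
    (p : ℕ) (hp : 1 ≤ p)
    (C₁ C₂ A : Set G) (hC₁ : C₁.Nonempty) (hC₂ : C₂.Nonempty) (hA : A.Nonempty)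
    (γ₁ γ₂ α : ℝ) (hγ₁ : γ₁ = density C₁) (hγ₂ : γ₂ = density C₂) (hα : α = density A)
    (f : G → ℝ) :
    ipWt (dcv (mu C₁) (mu C₂)) (fun x => dcv (mu A) (mu A) x ^ p) f =
      (Fintype.card G : ℝ) ^ (-(p : ℤ)) * α ^ (-(2 * (p : ℤ))) * γ₁⁻¹ * γ₂⁻¹ *
        ∑ s : Fin p → G,
          density (C₁ ∩ ⋂ i, (fun a => a + s i) '' A) *
            density (C₂ ∩ ⋂ i, (fun a => a + s i) '' A) *
            ip (dcv (mu (C₁ ∩ ⋂ i, (fun a => a + s i) '' A))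
                (mu (C₂ ∩ ⋂ i, (fun a => a + s i) '' A))) f ∧
    (0 < lpNormWt p (dcv (mu C₁) (mu C₂)) (dcv (mu A) (mu A)) →
      ∑ s : Fin p → G,
        density (C₁ ∩ ⋂ i, (fun a => a + s i) '' A) *
          density (C₂ ∩ ⋂ i, (fun a => a + s i) '' A) /
          ((Fintype.card G : ℝ) ^ p * α ^ (2 * p) * γ₁ * γ₂ *
            lpNormWt p (dcv (mu C₁) (mu C₂)) (dcv (mu A) (mu A)) ^ p) = 1) := by
  subst hγ₁ hγ₂ hα
  refine ⟨?_, fun hpos => ?_⟩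
  · simp only [density_mul_density_mul_ip]
    exact ipWt_dcv_mu_pow p C₁ C₂ A f
  · have hne := (pow_pos hpos p).ne'
    have hnorm := lpNormWt_pow (Nat.one_le_iff_ne_zero.mp hp)
      (dcv_mu_nonneg C₁ C₂) (dcv_mu_nonneg A A)
    rw [ipWt_dcv_mu_pow] at hnorm
    simp only [ip_dcv_indic_one] at hnorm
    have hG : (Fintype.card G : ℝ) ≠ 0 := by simp
    have h₁ := density_ne_zero hC₁
    have h₂ := density_ne_zero hC₂
    have hd := density_ne_zero hA
    have hpow : density A ^ (-(2 * (p : ℤ))) = (density A ^ (2 * p))⁻¹ := by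
      rw [zpow_neg]
      norm_cast
    rw [← Finset.sum_div, div_eq_one_iff_eq (by positivity), hnorm, hpow, zpow_neg, zpow_natCast]
    field_simp

end Formal
end

section
/- Let G be a finite abelian group, let B ⊆ G be a regular Bohr set, let A ⊆ B have relative density α > 0, and set β = |B|/|G|. Let C₁, C₂ ⊆ G be nonempty with densities γ₁, γ₂, and let μ = μ_{C₁}∘μ_{C₂}. Let p ≥ 1 be an integer and ε ∈ (0,1), and suppose ‖μ_A∘μ_A‖_{p(μ)} ≥ β^{−1}. Set S = {x ∈ G : μ_A∘μ_A(x) ≤ (1−ε)·‖μ_A∘μ_A‖_{p(μ)}}. Then there are nonempty sets A₁ ⊆ C₁ and A₂ ⊆ C₂, with |A₁|/|C₁| ≥ (1/4)·α^p and |A₂|/|C₂| ≥ (1/4)·α^p, such that ⟨μ_{A₁}∘μ_{A₂}, 1_{G∖S}⟩ ≥ 1 − 4(1−ε)^p. -/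
open Finset BigOperators Pointwise
open scoped Classical

namespace Formal

variable {G : Type*} [AddCommGroup G] [Fintype G]

lemma indic_nonneg {H : Type*} (S : Set H) (x : H) : 0 ≤ indic S x := by
  unfold indic; split_ifs <;> norm_num

lemma mu_eq_mul_indic {H : Type*} [Fintype H] (S : Set H) (x : H) :
    mu S x = (Fintype.card H : ℝ) / (Nat.card S : ℝ) * indic S x := by
  unfold mu indic; split_ifs <;> simp

lemma sum_indic {H : Type*} [Fintype H] (S : Set H) : ∑ x, indic S x = (Nat.card S : ℝ) := by
  simp only [indic, Finset.sum_boole, Nat.card_eq_fintype_card, Fintype.card_subtype]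

lemma card_pos_real : (0 : ℝ) < Fintype.card G := by
  exact_mod_cast Fintype.card_pos

lemma dcv_mu_eq (S T : Set G) (x : G) :
    dcv (mu S) (mu T) x = (Fintype.card G : ℝ) / ((Nat.card S : ℝ) * (Nat.card T : ℝ)) *
      ∑ y, indic S y * indic T (x + y) := by
  have hN := (card_pos_real (G := G)).ne'
  simp only [dcv, ex, mu_eq_mul_indic]
  rw [Finset.mul_sum, Finset.sum_div]
  refine Finset.sum_congr rfl fun y _ => ?_
  rw [div_eq_iff hN]
  ring

/-- Averaging against `μ_S ∘ μ_T` is averaging over differences of elements of `T` and `S`. -/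
lemma ex_dcv_mu_mul (S T : Set G) (h : G → ℝ) :
    ex (fun x => dcv (mu S) (mu T) x * h x) =
      (∑ a, ∑ b, indic S a * indic T b * h (b - a)) /
        ((Nat.card S : ℝ) * (Nat.card T : ℝ)) := by
  have hN := (card_pos_real (G := G)).ne'
  have key : ∑ x, (∑ y, indic S y * indic T (x + y)) * h x =
      ∑ a, ∑ b, indic S a * indic T b * h (b - a) := by
    simp only [Finset.sum_mul]
    rw [Finset.sum_comm]
    refine Finset.sum_congr rfl fun a _ => ?_
    exact Fintype.sum_equiv (Equiv.addRight a) _ _ fun x => by simp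
  simp only [ex, dcv_mu_eq, mul_assoc]
  rw [← Finset.mul_sum, key, div_mul_eq_mul_div, div_div, mul_comm _ (Fintype.card G : ℝ),
    mul_div_mul_left _ _ hN]
  simp only [mul_assoc]

lemma lpNormWt_natCast_pow {H : Type*} [Fintype H] {p : ℕ} (hp : 1 ≤ p)
    {ν f : H → ℝ} (hν : 0 ≤ ν) (hf : 0 ≤ f) :
    lpNormWt p ν f ^ p = ex (fun x => ν x * f x ^ p) := by
  have h0 : 0 ≤ ex (fun x => |f x| ^ (p : ℝ) * ν x) :=
    div_nonneg (Finset.sum_nonneg fun x _ =>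
      mul_nonneg (Real.rpow_nonneg (abs_nonneg _) _) (hν x)) (Nat.cast_nonneg _)
  rw [lpNormWt, one_div, Real.rpow_inv_natCast_pow h0 (by omega)]
  congr 1
  ext x
  rw [Real.rpow_natCast, abs_of_nonneg (hf x), mul_comm]

/-- The points of `C` lying in every translate `A + s j`. -/
def sift (A C : Set G) {p : ℕ} (s : Fin p → G) : Set G := {c | c ∈ C ∧ ∀ j, c - s j ∈ A}

lemma indic_sift {H : Type*} [AddCommGroup H] (A C : Set H) {p : ℕ} (s : Fin p → H) (c : H) :
    indic (sift A C s) c = indic C c * ∏ j, indic A (c - s j) := by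
  by_cases h : c ∈ C <;>
    simp only [indic, sift, Set.mem_ofPred_eq, Finset.prod_boole, Finset.mem_univ, true_imp_iff, h,
      true_and, false_and, if_true, if_false, one_mul, zero_mul]

lemma sum_indic_sub (A : Set G) (a b : G) :
    ∑ t, indic A (a - t) * indic A (b - t) = ∑ y, indic A y * indic A (b - a + y) :=
  Fintype.sum_equiv (Equiv.subLeft a) _ _ fun t => by simp

lemma sum_indic_sift_mul (A C₁ C₂ : Set G) (p : ℕ) (h : G → ℝ) :
    ∑ s : Fin p → G, ∑ a, ∑ b, indic (sift A C₁ s) a * indic (sift A C₂ s) b * h (b - a) =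
      ∑ a, ∑ b, indic C₁ a * indic C₂ b *
        ((∑ y, indic A y * indic A (b - a + y)) ^ p * h (b - a)) := by
  rw [Finset.sum_comm]
  refine Finset.sum_congr rfl fun a _ => ?_
  rw [Finset.sum_comm]
  refine Finset.sum_congr rfl fun b _ => ?_
  rw [← sum_indic_sub, Fintype.sum_pow, Finset.sum_mul, Finset.mul_sum]
  refine Finset.sum_congr rfl fun s _ => ?_
  rw [indic_sift, indic_sift, Finset.prod_mul_distrib]
  ring

lemma sum_card_sift (A C : Set G) (p : ℕ) :
    ∑ s : Fin p → G, (Nat.card (sift A C s) : ℝ) = (Nat.card C : ℝ) * (Nat.card A : ℝ) ^ p := by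
  simp only [← sum_indic, indic_sift]
  rw [Finset.sum_comm, Finset.sum_mul]
  refine Finset.sum_congr rfl fun c _ => ?_
  rw [← Finset.mul_sum, ← Fintype.sum_pow (fun t => indic A (c - t))]
  congr 2
  exact Fintype.sum_equiv (Equiv.subLeft c) _ _ fun t => by simp

lemma exists_large_of_sum_le {ι : Type*} [Fintype ι] {a b e : ι → ℝ} {q x y T : ℝ}
    (ha : ∀ s, 0 ≤ a s) (hb : ∀ s, 0 ≤ b s) (he : ∀ s, 0 ≤ e s) (hq : 0 < q) (hT : 0 < T)
    (hx : 0 ≤ x) (hy : 0 ≤ y)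
    (hab : ∑ s, a s * b s = T) (he' : ∑ s, e s ≤ q * T)
    (hxb : x * ∑ s, b s ≤ T / 4) (hya : y * ∑ s, a s ≤ T / 4) :
    ∃ s, x ≤ a s ∧ y ≤ b s ∧ e s ≤ 4 * q * (a s * b s) := by
  by_contra! hcon
  have hpt : ∀ s, 4 * q * (a s * b s) ≤ e s + 4 * q * (x * b s + y * a s) := fun s => by
    have h1 := mul_nonneg hx (hb s)
    have h2 := mul_nonneg hy (ha s)
    have h3 := he s
    by_cases hxa : x ≤ a s
    · by_cases hyb : y ≤ b s
      · have := hcon s hxa hyb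
        have : 0 ≤ 4 * q * (x * b s + y * a s) := by positivity
        linarith
      · have : a s * b s ≤ x * b s + y * a s := by nlinarith [ha s]
        nlinarith
    · have : a s * b s ≤ x * b s + y * a s := by nlinarith [hb s]
      nlinarith
  have hsum := Finset.sum_le_sum fun s (_ : s ∈ Finset.univ) => hpt s
  rw [← Finset.mul_sum, hab, Finset.sum_add_distrib, ← Finset.mul_sum, Finset.sum_add_distrib,
    ← Finset.mul_sum, ← Finset.mul_sum] at hsum
  nlinarith [mul_pos hq hT]

lemma natCard_pos_real {H : Type*} [Finite H] {S : Set H} (hS : S.Nonempty) :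
    (0 : ℝ) < Nat.card S := by
  have := hS.to_subtype
  exact_mod_cast Nat.card_pos

lemma sum_indic_mul_indic {H : Type*} [Fintype H] (S T : Set H) :
    ∑ a, ∑ b, indic S a * indic T b = (Nat.card S : ℝ) * (Nat.card T : ℝ) := by
  rw [← Finset.sum_mul_sum, sum_indic, sum_indic]

lemma nonempty_of_natCard_pos {H : Type*} {S : Set H} (hS : (0 : ℝ) < Nat.card S) :
    S.Nonempty := by
  rw [Nat.cast_pos] at hS
  exact Set.nonempty_coe_sort.1 (Nat.card_pos_iff.1 hS).1

lemma indic_compl {H : Type*} (S : Set H) (x : H) : indic Sᶜ x = 1 - indic S x := by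
  unfold indic
  by_cases h : x ∈ S <;> simp [h]

/-- If the pairs of `S × T` with difference in `U` have proportion at most `q`, then
`μ_S ∘ μ_T` gives mass at least `1 - q` to the complement of `U`. -/
lemma le_ip_dcv_mu_indic_compl {S T U : Set G} (hS : S.Nonempty) (hT : T.Nonempty) {q : ℝ}
    (h : ∑ a, ∑ b, indic S a * indic T b * indic U (b - a) ≤
      q * ((Nat.card S : ℝ) * (Nat.card T : ℝ))) :
    1 - q ≤ ip (dcv (mu S) (mu T)) (indic Uᶜ) := by
  have hST := mul_pos (natCard_pos_real hS) (natCard_pos_real hT)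
  rw [ip, ex_dcv_mu_mul, le_div_iff₀ hST]
  simp only [indic_compl, mul_sub, mul_one, Finset.sum_sub_distrib]
  rw [sum_indic_mul_indic]
  linarith

/-- Weighted sifting: if `‖μ_A∘μ_A‖_{p(μ)} ≥ β⁻¹` then there are
`A₁ ⊆ C₁`, `A₂ ⊆ C₂` of relative density `≥ α^p/4` with
`⟨μ_{A₁}∘μ_{A₂}, 1_{G∖S}⟩ ≥ 1 − 4(1−ε)^p`. -/
theorem statement10 {G : Type*} [AddCommGroup G] [Fintype G]
    (B : Bohr G) (hB : B.Regular)
    (A : Set G) (hAB : A ⊆ B.carrier)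
    (α : ℝ) (hα : α = relDensity A B.carrier) (hα0 : 0 < α)
    (β : ℝ) (hβ : β = density B.carrier)
    (C₁ C₂ : Set G) (hC₁ : C₁.Nonempty) (hC₂ : C₂.Nonempty)
    (γ₁ γ₂ : ℝ) (hγ₁ : γ₁ = density C₁) (hγ₂ : γ₂ = density C₂)
    (p : ℕ) (hp : 1 ≤ p) (ε : ℝ) (hε : ε ∈ Set.Ioo (0 : ℝ) 1)
    (hnorm : β⁻¹ ≤ lpNormWt p (dcv (mu C₁) (mu C₂)) (dcv (mu A) (mu A))) :
    ∃ A₁ A₂ : Set G, A₁.Nonempty ∧ A₂.Nonempty ∧ A₁ ⊆ C₁ ∧ A₂ ⊆ C₂ ∧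
      (1 / 4 : ℝ) * α ^ p ≤ relDensity A₁ C₁ ∧
      (1 / 4 : ℝ) * α ^ p ≤ relDensity A₂ C₂ ∧
      1 - 4 * (1 - ε) ^ p ≤
        ip (dcv (mu A₁) (mu A₂))
          (indic {x | dcv (mu A) (mu A) x ≤
              (1 - ε) * lpNormWt p (dcv (mu C₁) (mu C₂)) (dcv (mu A) (mu A))}ᶜ) := by
  have hN := card_pos_real (G := G)
  have hb0 : (0 : ℝ) < Nat.card B.carrier := by
    rcases (Nat.cast_nonneg (α := ℝ) (Nat.card B.carrier)).lt_or_eq with h | h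
    · exact h
    · rw [hα, relDensity, ← h, div_zero] at hα0
      exact absurd hα0 (lt_irrefl _)
  have ha0 : (0 : ℝ) < Nat.card A := by
    rw [hα, relDensity, lt_div_iff₀ hb0, zero_mul] at hα0
    exact hα0
  have hc1 := natCard_pos_real hC₁
  have hc2 := natCard_pos_real hC₂
  obtain ⟨-, hε1⟩ := hε
  set f := dcv (mu A) (mu A) with hf
  set M := lpNormWt p (dcv (mu C₁) (mu C₂)) f with hM
  set U : Set G := {x | f x ≤ (1 - ε) * M} with hU
  have hdcv : ∀ S T : Set G, 0 ≤ dcv (mu S) (mu T) := fun S T x => by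
    rw [dcv_mu_eq]
    exact mul_nonneg (by positivity)
      (Finset.sum_nonneg fun y _ => mul_nonneg (indic_nonneg _ _) (indic_nonneg _ _))
  set k : ℝ := (Nat.card A : ℝ) * Nat.card A / Fintype.card G with hk
  have hk0 : 0 < k := by positivity
  have hr : ∀ x, ∑ y, indic A y * indic A (x + y) = k * f x := fun x => by
    rw [hf, dcv_mu_eq, hk]
    field_simp
  have hβM : (Fintype.card G : ℝ) / Nat.card B.carrier ≤ M := by
    simpa [hβ, density] using hnorm
  have hM0 : 0 < M := lt_of_lt_of_le (by positivity) hβM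
  have hMp : ∑ a, ∑ b, indic C₁ a * indic C₂ b * f (b - a) ^ p =
      M ^ p * ((Nat.card C₁ : ℝ) * Nat.card C₂) := by
    rw [hM, lpNormWt_natCast_pow hp (hdcv _ _) (hdcv _ _),
      ex_dcv_mu_mul C₁ C₂ (fun x => f x ^ p), div_mul_cancel₀ _ (by positivity)]
  set T : ℝ := k ^ p * (M ^ p * ((Nat.card C₁ : ℝ) * Nat.card C₂)) with hT
  have hT0 : 0 < T := by positivity
  have hTle : α ^ p * (Nat.card A : ℝ) ^ p * ((Nat.card C₁ : ℝ) * Nat.card C₂) ≤ T := by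
    rw [hT, ← mul_assoc (k ^ p), ← mul_pow, ← mul_pow]
    have : α * Nat.card A = k * ((Fintype.card G : ℝ) / Nat.card B.carrier) := by
      rw [hα, relDensity, hk]
      field_simp
    rw [this]
    gcongr
  have hab : ∑ s : Fin p → G, (Nat.card (sift A C₁ s) : ℝ) * Nat.card (sift A C₂ s) = T := by
    have h := sum_indic_sift_mul A C₁ C₂ p (fun _ => 1)
    simp only [mul_one, sum_indic_mul_indic, hr, mul_pow] at h
    rw [h, hT, ← hMp, Finset.mul_sum]
    refine Finset.sum_congr rfl fun a _ => ?_
    rw [Finset.mul_sum]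
    exact Finset.sum_congr rfl fun b _ => by ring
  have he' : ∑ s : Fin p → G, ∑ a, ∑ b,
      indic (sift A C₁ s) a * indic (sift A C₂ s) b * indic U (b - a) ≤ (1 - ε) ^ p * T := by
    rw [sum_indic_sift_mul]
    have h : (1 - ε) ^ p * T =
        ∑ a, ∑ b, indic C₁ a * indic C₂ b * (k ^ p * ((1 - ε) * M) ^ p) := by
      simp only [← Finset.sum_mul, sum_indic_mul_indic]
      rw [hT, mul_pow]
      ring
    rw [h]
    refine Finset.sum_le_sum fun a _ => Finset.sum_le_sum fun b _ =>
      mul_le_mul_of_nonneg_left ?_ (mul_nonneg (indic_nonneg _ _) (indic_nonneg _ _))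
    have hq : 0 ≤ (1 - ε) * M := mul_nonneg (by linarith) hM0.le
    rw [hr, mul_pow, indic]
    split_ifs with hx
    · rw [mul_one]
      have := pow_le_pow_left₀ (hdcv A A (b - a)) hx p
      gcongr
    · rw [mul_zero]
      positivity
  obtain ⟨s, h1, h2, h3⟩ := exists_large_of_sum_le
    (x := 1 / 4 * α ^ p * Nat.card C₁) (y := 1 / 4 * α ^ p * Nat.card C₂)
    (fun s => Nat.cast_nonneg _) (fun s => Nat.cast_nonneg _)
    (fun s => Finset.sum_nonneg fun a _ => Finset.sum_nonneg fun b _ =>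
      mul_nonneg (mul_nonneg (indic_nonneg _ _) (indic_nonneg _ _)) (indic_nonneg _ _))
    (pow_pos (sub_pos.2 hε1) p) hT0 (by positivity) (by positivity) hab he'
    (by rw [sum_card_sift]; linarith) (by rw [sum_card_sift]; linarith)
  have hA1 := nonempty_of_natCard_pos (lt_of_lt_of_le (by positivity) h1)
  have hA2 := nonempty_of_natCard_pos (lt_of_lt_of_le (by positivity) h2)
  refine ⟨sift A C₁ s, sift A C₂ s, hA1, hA2, fun c hc => hc.1, fun c hc => hc.1, ?_, ?_, ?_⟩
  · rwa [relDensity, le_div_iff₀ hc1]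
  · rwa [relDensity, le_div_iff₀ hc2]
  · exact le_ip_dcv_mu_indic_compl hA1 hA2 h3

end Formal
end
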